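/- Let p be a prime and f : 𝔽_{p^n} → 𝔽_p a partially bent function with f(0) = 0 which is s-plateaued and whose linear space has dimension s. Consider the incidence structure whose point set is 𝔽_{p^n} × 𝔽_p and whose blocks are the distinct translates (u,v) + G_f of the graph G_f. Then this is a partial geometric design with parameters v = p^{n+1}, b = p^{n+1−s}, k = p^n, r = p^{n−s}, α = p^{2n−1−s} − p^{n−1}, β = p^n + p^{2n−1−s} − p^{n−1}: there are p^{n+1−s} distinct blocks, every block has p^n points, every point lies on p^{n−s} blocks, and for every point z and every block B, ∑_{y ∈ B} #{blocks C : z ∈ C and y ∈ C} = α when z ∉ B and = β when z ∈ B. -/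

import Mathlib

open scoped BigOperators Classical

noncomputable instance galFintype (p n : ℕ) [Fact p.Prime] : Fintype (GaloisField p n) :=
  Fintype.ofFinite _

/-- `eChar p k = ζ_p ^ k` where `ζ_p = exp(2πi/p)` and `k : ZMod p`. -/
noncomputable def eChar (p : ℕ) (k : ZMod p) : ℂ :=
  Complex.exp (2 * Real.pi * Complex.I / p) ^ k.val

/-- Absolute trace `Tr_n : 𝔽_{p^n} → 𝔽_p`. -/
noncomputable def trGF (p n : ℕ) [Fact p.Prime] (x : GaloisField p n) : ZMod p :=
  Algebra.trace (ZMod p) (GaloisField p n) x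

/-- Walsh transform `f̂(μ) = ∑_x ζ_p^{f(x) - Tr_n(μ x)}`. -/
noncomputable def walsh (p n : ℕ) [Fact p.Prime] (f : GaloisField p n → ZMod p)
    (μ : GaloisField p n) : ℂ :=
  ∑ x : GaloisField p n, eChar p (f x - trGF p n (μ * x))

/-- `f` is `s`-plateaued: `|f̂(μ)| ∈ {0, p^{(n+s)/2}}` for all `μ`. -/
def IsPlateaued (p n : ℕ) [Fact p.Prime] (f : GaloisField p n → ZMod p) (s : ℕ) : Prop :=
  ∀ μ : GaloisField p n, ‖walsh p n f μ‖ = 0 ∨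
    ‖walsh p n f μ‖ = (p : ℝ) ^ (((n : ℝ) + (s : ℝ)) / 2)

/-- `δ_S(g) = #{(s,t) ∈ S × S : g = s - t}`. -/
def pgdsDelta {G : Type*} [AddCommGroup G] [DecidableEq G] (S : Finset G) (g : G) : ℕ :=
  ((S ×ˢ S).filter fun st => g = st.1 - st.2).card

/-- `S` is a partial geometric difference set with parameters `(v, k; α, β)`. -/
def IsPGDS {G : Type*} [AddCommGroup G] [Fintype G] [DecidableEq G]
    (S : Finset G) (v k α β : ℕ) : Prop :=
  Fintype.card G = v ∧ S.card = k ∧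
    ∀ x : G, (∑ y ∈ S, pgdsDelta S (x - y)) = if x ∈ S then β else α

/-- The translate `(u,v) + G_f` of the graph of `f`, as a finset. -/
noncomputable def translGraph (p n : ℕ) [Fact p.Prime] (f : GaloisField p n → ZMod p)
    (u : GaloisField p n) (v : ZMod p) : Finset (GaloisField p n × ZMod p) :=
  (Finset.univ : Finset (GaloisField p n)).image fun x => (x + u, f x + v)

/-- The collection of distinct translates of the graph of `f`. -/
noncomputable def graphBlocks (p n : ℕ) [Fact p.Prime] (f : GaloisField p n → ZMod p) :
    Finset (Finset (GaloisField p n × ZMod p)) :=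
  (Finset.univ : Finset (GaloisField p n × ZMod p)).image fun uv =>
    translGraph p n f uv.1 uv.2

section TranslateCounting

variable {p n : ℕ} [Fact p.Prime] {f : GaloisField p n → ZMod p}

theorem mem_translGraph {u : GaloisField p n} {v : ZMod p} {z : GaloisField p n × ZMod p} :
    z ∈ translGraph p n f u v ↔ f (z.1 - u) + v = z.2 := by
  simp only [translGraph, Finset.mem_image, Finset.mem_univ, true_and]
  constructor
  · rintro ⟨x, rfl⟩
    simp
  · intro h
    exact ⟨z.1 - u, Prod.ext (by simp) h⟩

theorem card_translGraph (hn : 0 < n) (u : GaloisField p n) (v : ZMod p) :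
    (translGraph p n f u v).card = p ^ n := by
  rw [translGraph, Finset.card_image_of_injective]
  · rw [Finset.card_univ, ← Nat.card_eq_fintype_card, GaloisField.card p n hn.ne']
  · intro x y h
    exact add_right_cancel (Prod.ext_iff.1 h).1

theorem sum_translGraph (u : GaloisField p n) (v : ZMod p)
    (g : GaloisField p n × ZMod p → ℕ) :
    ∑ y ∈ translGraph p n f u v, g y = ∑ x, g (x, f (x - u) + v) := by
  rw [translGraph, Finset.sum_image]
  · exact Fintype.sum_equiv (Equiv.addRight u) _ _ (by simp)
  · intro x _ y _ h
    exact add_right_cancel (Prod.ext_iff.1 h).1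

/-- Two translates coincide exactly when their offsets differ by `(a, f a)` for some `a`
in the linear space. -/
theorem translGraph_eq_iff (h0 : f 0 = 0) {Λ : Submodule (ZMod p) (GaloisField p n)}
    (hΛ : ∀ a, a ∈ Λ ↔ ∃ c, ∀ x, f (x + a) - f x = c)
    {u u' : GaloisField p n} {v v' : ZMod p} :
    translGraph p n f u v = translGraph p n f u' v' ↔
      u - u' ∈ Λ ∧ v = v' + f (u - u') := by
  constructor
  · intro h
    have key : ∀ x, f (x + (u - u')) - f x = v - v' := by
      intro x
      have hx : ((x + u, f x + v) : GaloisField p n × ZMod p) ∈ translGraph p n f u v := by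
        simp [mem_translGraph]
      rw [h, mem_translGraph] at hx
      dsimp only at hx
      rw [← add_sub_assoc]
      linear_combination hx
    refine ⟨(hΛ _).2 ⟨_, key⟩, ?_⟩
    have := key 0
    rw [zero_add, h0] at this
    linear_combination -this
  · rintro ⟨ha, hv⟩
    obtain ⟨c, hc⟩ := (hΛ _).1 ha
    have hc0 := hc 0
    rw [zero_add, h0] at hc0
    ext z
    rw [mem_translGraph, mem_translGraph]
    have hz := hc (z.1 - u)
    rw [sub_add_sub_cancel] at hz
    have : f (z.1 - u) + v = f (z.1 - u') + v' := by
      linear_combination hv + hc0 - hz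
    rw [this]

theorem card_filter_translGraph_eq (h0 : f 0 = 0)
    {Λ : Submodule (ZMod p) (GaloisField p n)}
    (hΛ : ∀ a, a ∈ Λ ↔ ∃ c, ∀ x, f (x + a) - f x = c)
    (u : GaloisField p n) (v : ZMod p) :
    (Finset.univ.filter fun w : GaloisField p n × ZMod p =>
      translGraph p n f w.1 w.2 = translGraph p n f u v).card =
      (Finset.univ.filter fun a => a ∈ Λ).card := by
  symm
  refine Finset.card_bij' (fun a _ => (a + u, v + f a)) (fun w _ => w.1 - u) ?_ ?_ ?_ ?_
  · intro a ha
    simpa [translGraph_eq_iff h0 hΛ] using ha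
  · intro w hw
    simp only [Finset.mem_filter, Finset.mem_univ, true_and, translGraph_eq_iff h0 hΛ] at hw ⊢
    exact hw.1
  · intro a _
    simp
  · intro w hw
    simp only [Finset.mem_filter, Finset.mem_univ, true_and, translGraph_eq_iff h0 hΛ] at hw
    exact Prod.ext (by simp) hw.2.symm

/-- Counting offsets counts every block once for each element of the linear space. -/
theorem card_filter_graphBlocks_mul (h0 : f 0 = 0)
    {Λ : Submodule (ZMod p) (GaloisField p n)}
    (hΛ : ∀ a, a ∈ Λ ↔ ∃ c, ∀ x, f (x + a) - f x = c)
    (P : Finset (GaloisField p n × ZMod p) → Prop) [DecidablePred P] :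
    ((graphBlocks p n f).filter P).card * (Finset.univ.filter fun a => a ∈ Λ).card =
      (Finset.univ.filter fun w : GaloisField p n × ZMod p =>
        P (translGraph p n f w.1 w.2)).card := by
  symm
  rw [Finset.card_eq_sum_card_fiberwise
    (f := fun w : GaloisField p n × ZMod p => translGraph p n f w.1 w.2)
    (t := (graphBlocks p n f).filter P), Finset.sum_const_nat]
  · intro B hB
    obtain ⟨hB, hP⟩ := Finset.mem_filter.1 hB
    obtain ⟨w, -, rfl⟩ := Finset.mem_image.1 hB
    rw [← card_filter_translGraph_eq h0 hΛ w.1 w.2, Finset.filter_filter]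
    congr 1
    ext w'
    simp only [Finset.mem_filter, Finset.mem_univ, true_and, and_iff_right_iff_imp]
    intro h
    rwa [h]
  · intro w hw
    simp only [Finset.coe_filter, Finset.mem_univ, true_and, Set.mem_ofPred_eq] at hw ⊢
    exact ⟨Finset.mem_image_of_mem _ (Finset.mem_univ w), hw⟩

/-- Offsets of translates through `z` satisfying `Q` are determined by their first
coordinate. -/
theorem card_filter_offset (z : GaloisField p n × ZMod p)
    (Q : GaloisField p n × ZMod p → Prop) [DecidablePred Q] :
    (Finset.univ.filter fun w : GaloisField p n × ZMod p =>
      z ∈ translGraph p n f w.1 w.2 ∧ Q w).card =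
      (Finset.univ.filter fun x => Q (z.1 - x, z.2 - f x)).card := by
  refine Finset.card_bij' (fun w _ => z.1 - w.1) (fun x _ => (z.1 - x, z.2 - f x)) ?_ ?_ ?_ ?_
  · intro w hw
    simp only [Finset.mem_filter, Finset.mem_univ, true_and, mem_translGraph] at hw ⊢
    rw [← hw.1, sub_sub_cancel, add_sub_cancel_left]
    exact hw.2
  · intro x hx
    simpa [mem_translGraph] using hx
  · intro w hw
    simp only [Finset.mem_filter, Finset.mem_univ, true_and, mem_translGraph] at hw
    exact Prod.ext (by simp) (by rw [← hw.1]; simp)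
  · intro x _
    simp

theorem card_filter_offset_pair (z y : GaloisField p n × ZMod p) :
    (Finset.univ.filter fun w : GaloisField p n × ZMod p =>
      z ∈ translGraph p n f w.1 w.2 ∧ y ∈ translGraph p n f w.1 w.2).card =
      (Finset.univ.filter fun x => f (x + (y.1 - z.1)) - f x = y.2 - z.2).card := by
  rw [card_filter_offset z fun w => y ∈ translGraph p n f w.1 w.2]
  congr 1
  ext x
  simp only [Finset.mem_filter, Finset.mem_univ, true_and, mem_translGraph]
  rw [show y.1 - (z.1 - x) = x + (y.1 - z.1) by ring]
  constructor <;> intro h <;> linear_combination h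

/-- The number of offsets of translates through `z` and a point of a given block. -/
theorem card_filter_offset_block (hn : 0 < n)
    (hpb : ∀ a : GaloisField p n,
      (∀ c, (Finset.univ.filter fun x => f (x + a) - f x = c).card = p ^ (n - 1)) ∨
      (∃ c, ∀ x, f (x + a) - f x = c))
    {Λ : Submodule (ZMod p) (GaloisField p n)}
    (hΛ : ∀ a, a ∈ Λ ↔ ∃ c, ∀ x, f (x + a) - f x = c)
    (z : GaloisField p n × ZMod p) (u : GaloisField p n) (v : ZMod p) (t : GaloisField p n) :
    (Finset.univ.filter fun x => f (x + (t - z.1)) - f x = f (t - u) + v - z.2).card =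
      if t - z.1 ∈ Λ then (if z ∈ translGraph p n f u v then p ^ n else 0)
      else p ^ (n - 1) := by
  split_ifs with ht hz
  · obtain ⟨c, hc⟩ := (hΛ _).1 ht
    have h := hc (z.1 - u)
    rw [sub_add_sub_cancel'] at h
    rw [mem_translGraph] at hz
    rw [Finset.filter_true_of_mem, Finset.card_univ, ← Nat.card_eq_fintype_card,
      GaloisField.card p n hn.ne']
    intro x _
    rw [hc x]
    linear_combination -hz - h
  · obtain ⟨c, hc⟩ := (hΛ _).1 ht
    have h := hc (z.1 - u)
    rw [sub_add_sub_cancel'] at h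
    rw [mem_translGraph] at hz
    rw [Finset.card_eq_zero, Finset.filter_eq_empty_iff]
    intro x _ hx
    rw [hc x] at hx
    exact hz (by linear_combination -h - hx)
  · exact (hpb _).resolve_right (fun h => ht ((hΛ _).2 h)) _

end TranslateCounting

/-- a partially bent `s`-plateaued function `f` with `f(0) = 0` whose
linear space has dimension `s` yields a partial geometric design with parameters
`v = p^{n+1}`, `b = p^{n+1-s}`, `k = p^n`, `r = p^{n-s}`, `α = p^{2n-1-s} - p^{n-1}`,
`β = p^n + p^{2n-1-s} - p^{n-1}`, whose points are `𝔽_{p^n} × 𝔽_p` and whose blocks are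
the distinct translates of the graph of `f`. -/
theorem stmt16 (p n : ℕ) [Fact p.Prime] (hn : 0 < n) (s : ℕ)
    (f : GaloisField p n → ZMod p)
    (hpb : ∀ a : GaloisField p n,
      (∀ c : ZMod p,
        ((Finset.univ : Finset (GaloisField p n)).filter fun x => f (x + a) - f x = c).card =
          p ^ (n - 1)) ∨
      (∃ c : ZMod p, ∀ x : GaloisField p n, f (x + a) - f x = c))
    (hf : IsPlateaued p n f s) (h0 : f 0 = 0)
    (Λ : Submodule (ZMod p) (GaloisField p n))
    (hΛ : ∀ a : GaloisField p n,
      a ∈ Λ ↔ ∃ c : ZMod p, ∀ x : GaloisField p n, f (x + a) - f x = c)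
    (hdim : Module.finrank (ZMod p) Λ = s) :
    Fintype.card (GaloisField p n × ZMod p) = p ^ (n + 1) ∧
    (graphBlocks p n f).card = p ^ (n + 1 - s) ∧
    (∀ B ∈ graphBlocks p n f, B.card = p ^ n) ∧
    (∀ z : GaloisField p n × ZMod p,
      ((graphBlocks p n f).filter fun B => z ∈ B).card = p ^ (n - s)) ∧
    (∀ (z : GaloisField p n × ZMod p), ∀ B ∈ graphBlocks p n f,
      (∑ y ∈ B, ((graphBlocks p n f).filter fun C => z ∈ C ∧ y ∈ C).card) =
        if z ∈ B then p ^ n + p ^ (2 * n - 1 - s) - p ^ (n - 1)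
        else p ^ (2 * n - 1 - s) - p ^ (n - 1)) := by
  have hcard : Fintype.card (GaloisField p n) = p ^ n := by
    rw [← Nat.card_eq_fintype_card, GaloisField.card p n hn.ne']
  have hpos : 0 < p := (Fact.out : p.Prime).pos
  have hs : s ≤ n := by
    rw [← hdim]
    exact (Submodule.finrank_le Λ).trans_eq (GaloisField.finrank p hn.ne')
  have hL : (Finset.univ.filter fun a => a ∈ Λ).card = p ^ s := by
    rw [← Fintype.card_subtype, ← hdim]
    simpa using Module.card_eq_pow_finrank (K := ZMod p) (V := Λ)
  have hcount (P : Finset (GaloisField p n × ZMod p) → Prop) [DecidablePred P] :=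
    hL ▸ card_filter_graphBlocks_mul h0 hΛ P
  have hLpos : 0 < p ^ s := pow_pos hpos s
  have htotal : Fintype.card (GaloisField p n × ZMod p) = p ^ (n + 1) := by
    rw [Fintype.card_prod, hcard, ZMod.card, pow_succ]
  refine ⟨htotal, ?_, ?_, ?_, ?_⟩
  · apply Nat.eq_of_mul_eq_mul_right hLpos
    have h := hcount fun _ => True
    rw [Finset.filter_true, Finset.filter_true, Finset.card_univ, htotal] at h
    rw [h, ← pow_add]
    congr 1
    omega
  · intro B hB
    obtain ⟨w, -, rfl⟩ := Finset.mem_image.1 hB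
    exact card_translGraph hn _ _
  · intro z
    apply Nat.eq_of_mul_eq_mul_right hLpos
    have h := card_filter_offset (f := f) z fun _ => True
    simp only [and_true, Finset.filter_true, Finset.card_univ, hcard] at h
    rw [hcount, h, ← pow_add]
    congr 1
    omega
  · intro z B hB
    obtain ⟨⟨u, v⟩, -, rfl⟩ := Finset.mem_image.1 hB
    dsimp only
    apply Nat.eq_of_mul_eq_mul_right hLpos
    have hshift : (Finset.univ.filter fun t => t - z.1 ∈ Λ).card = p ^ s := by
      rw [← hL]
      refine Finset.card_equiv (Equiv.subRight z.1) ?_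
      simp
    have hcompl : (Finset.univ.filter fun t => ¬ t - z.1 ∈ Λ).card = p ^ n - p ^ s := by
      have h := Finset.card_filter_add_card_filter_not
        (s := (Finset.univ : Finset (GaloisField p n))) (fun t => t - z.1 ∈ Λ)
      rw [hshift, Finset.card_univ, hcard] at h
      omega
    rw [Finset.sum_mul, Finset.sum_congr rfl fun y _ => hcount _]
    simp only [card_filter_offset_pair]
    rw [sum_translGraph]
    simp only [card_filter_offset_block hn hpb hΛ]
    rw [Finset.sum_ite, Finset.sum_const, Finset.sum_const, hshift, hcompl, smul_eq_mul,
      smul_eq_mul]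
    obtain ⟨m, rfl⟩ : ∃ m, n = m + 1 := ⟨n - 1, by omega⟩
    have h1 : p ^ (2 * (m + 1) - 1 - s) * p ^ s = p ^ (m + 1) * p ^ m := by
      rw [← pow_add, ← pow_add]
      congr 1
      omega
    have hα : (p ^ (2 * (m + 1) - 1 - s) - p ^ m) * p ^ s = (p ^ (m + 1) - p ^ s) * p ^ m := by
      rw [Nat.sub_mul, Nat.sub_mul, h1, mul_comm (p ^ m)]
    have hle : p ^ m ≤ p ^ (2 * (m + 1) - 1 - s) := Nat.pow_le_pow_right hpos (by omega)
    rw [Nat.add_sub_cancel]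
    split_ifs
    · rw [Nat.add_sub_assoc hle, add_mul, hα, mul_comm (p ^ s)]
    · rw [hα, mul_zero, zero_add]
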